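/- arXiv:0705.1663 — 2 statements merged into one kernel-verified Lean document; each statement's English description precedes it below -/
import Mathlib

section
/- For every biquadratic polynomial h(x,y) with complex coefficients, δ_{x,y}(δ_{x,y}(h)) = −4·i₃(h)·h, where δ_{x,y}(h) := h_x h_y − h h_{xy} (which is again biquadratic). -/
open MvPolynomial

/-- `δ_{x,y}(h) = h_x h_y - h h_{xy}` for a polynomial of two variables (`x` is the
variable indexed `0`, `y` the one indexed `1`). -/
noncomputable def ddh (h : MvPolynomial (Fin 2) ℂ) : MvPolynomial (Fin 2) ℂ :=
  pderiv 0 h * pderiv 1 h - h * pderiv 0 (pderiv 1 h)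

/-- The coefficient `h_{ij}` of `x^i y^j` in `h(x,y)`. -/
noncomputable def cf (h : MvPolynomial (Fin 2) ℂ) (i j : ℕ) : ℂ :=
  h.coeff (Finsupp.single (0 : Fin 2) i + Finsupp.single (1 : Fin 2) j)

/-- `i₃(h) = det [[h₂₂, h₂₁, h₂₀], [h₁₂, h₁₁, h₁₀], [h₀₂, h₀₁, h₀₀]]` for a biquadratic
`h(x,y) = Σ h_{ij} x^i y^j`. -/
noncomputable def inv3 (h : MvPolynomial (Fin 2) ℂ) : ℂ :=
  Matrix.det !![cf h 2 2, cf h 2 1, cf h 2 0;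
                cf h 1 2, cf h 1 1, cf h 1 0;
                cf h 0 2, cf h 0 1, cf h 0 0]

theorem eq_sum_of_degreeOf_le_two (h : MvPolynomial (Fin 2) ℂ) (hh : ∀ i, h.degreeOf i ≤ 2) :
    h = ∑ i ∈ Finset.range 3, ∑ j ∈ Finset.range 3, C (cf h i j) * (X 0 ^ i * X 1 ^ j) := by
  have mon (i j : ℕ) : C (cf h i j) * (X 0 ^ i * X 1 ^ j) =
      monomial (Finsupp.single (0 : Fin 2) i + Finsupp.single (1 : Fin 2) j) (cf h i j) := by
    rw [X_pow_eq_monomial, X_pow_eq_monomial, monomial_mul, C_mul_monomial]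
    simp
  have key (m : Fin 2 →₀ ℕ) (i j : ℕ) :
      Finsupp.single (0 : Fin 2) i + Finsupp.single (1 : Fin 2) j = m ↔ i = m 0 ∧ j = m 1 := by
    simp [Finsupp.ext_iff, Fin.forall_fin_two]
  ext m
  simp only [mon, coeff_sum, coeff_monomial, key, ite_and, Finset.sum_ite_irrel,
    Finset.sum_const_zero, Finset.sum_ite_eq', Finset.mem_range]
  have hm : cf h (m 0) (m 1) = coeff m h := by
    rw [cf, (key m _ _).2 ⟨rfl, rfl⟩]
  by_cases hc : coeff m h = 0
  · simp [hm, hc]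
  · have hle (i : Fin 2) : m i < 3 :=
      Nat.lt_succ_of_le ((le_degreeOf_of_mem_support i (mem_support_iff.2 hc)).trans (hh i))
    simp [hm, hle]

/-- For `h` quadratic in `x`, the coefficients of `δ(h)` are Wronskians in `y` of those of `h`. -/
theorem ddh_quadratic {p q r : MvPolynomial (Fin 2) ℂ}
    (hp : pderiv 0 p = 0) (hq : pderiv 0 q = 0) (hr : pderiv 0 r = 0)
    (hp' : pderiv 0 (pderiv 1 p) = 0) (hq' : pderiv 0 (pderiv 1 q) = 0)
    (hr' : pderiv 0 (pderiv 1 r) = 0) :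
    ddh (p * X 0 ^ 2 + q * X 0 + r) =
      (p * pderiv 1 q - q * pderiv 1 p) * X 0 ^ 2 + (2 * (p * pderiv 1 r - r * pderiv 1 p)) * X 0
        + (q * pderiv 1 r - r * pderiv 1 q) := by
  simp only [ddh, map_add, Derivation.leibniz, Derivation.leibniz_pow, pderiv_X_self,
    pderiv_X_of_ne (show (0 : Fin 2) ≠ 1 by decide), hp, hq, hr, hp', hq', hr', smul_eq_mul,
    nsmul_eq_mul, map_zero, mul_zero]
  push_cast
  ring

/-- For every biquadratic polynomial `h(x,y)`, `δ_{x,y}(δ_{x,y}(h)) = -4 i₃(h) h`. -/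
theorem statement6 (h : MvPolynomial (Fin 2) ℂ) (hh : ∀ i, h.degreeOf i ≤ 2) :
    ddh (ddh h) = C (-4 * inv3 h) * h := by
  let P (i : ℕ) : MvPolynomial (Fin 2) ℂ :=
    C (cf h i 2) * X 1 ^ 2 + C (cf h i 1) * X 1 + C (cf h i 0)
  have hP : h = P 2 * X 0 ^ 2 + P 1 * X 0 + P 0 := by
    conv_lhs => rw [eq_sum_of_degreeOf_le_two h hh]
    simp only [Finset.sum_range_succ, Finset.sum_range_zero, P]
    ring
  have d0 (i : ℕ) : pderiv 0 (P i) = 0 := by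
    simp [P, Derivation.leibniz_pow]
  have d1 (i : ℕ) : pderiv 1 (P i) = 2 * C (cf h i 2) * X 1 + C (cf h i 1) := by
    simp [P, Derivation.leibniz_pow]
    ring
  have two (i : Fin 2) : pderiv i (2 : MvPolynomial (Fin 2) ℂ) = 0 := by
    exact_mod_cast (pderiv i).map_natCast 2
  have d01 (i : ℕ) : pderiv 0 (pderiv 1 (P i)) = 0 := by
    simp [d1, two]
  have d11 (i : ℕ) : pderiv 1 (pderiv 1 (P i)) = 2 * C (cf h i 2) := by
    simp [d1, two]
  have d011 (i : ℕ) : pderiv 0 (pderiv 1 (pderiv 1 (P i))) = 0 := by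
    simp [d11, two]
  have wronskian : C (-4 * inv3 h) =
      2 * (P 2 * (pderiv 1 (P 1) * pderiv 1 (pderiv 1 (P 0))
          - pderiv 1 (P 0) * pderiv 1 (pderiv 1 (P 1)))
        - P 1 * (pderiv 1 (P 2) * pderiv 1 (pderiv 1 (P 0))
          - pderiv 1 (P 0) * pderiv 1 (pderiv 1 (P 2)))
        + P 0 * (pderiv 1 (P 2) * pderiv 1 (pderiv 1 (P 1))
          - pderiv 1 (P 1) * pderiv 1 (pderiv 1 (P 2)))) := by
    have four : (C 4 : MvPolynomial (Fin 2) ℂ) = 4 := map_ofNat C 4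
    simp only [d11]
    simp [d1, P, inv3, Matrix.det_fin_three, four]
    ring
  rw [wronskian]
  conv_rhs => rw [hP]
  conv_lhs => rw [hP]
  clear_value P
  rw [ddh_quadratic (d0 2) (d0 1) (d0 0) (d01 2) (d01 1) (d01 0), ddh_quadratic]
  · simp only [map_sub, Derivation.leibniz, two, smul_eq_mul]
    ring
  all_goals simp [d0, d01, d011, two]
end

section
/- Let h(x,y) = Σ_{i,j=0}^{2} h_{ij} x^i y^j be a biquadratic polynomial with complex coefficients, let a₁,b₁,c₁,d₁,a₂,b₂,c₂,d₂ ∈ ℂ, and define M[h](x,y) := Σ_{i,j=0}^{2} h_{ij} (a₁x + b₁)^i (c₁x + d₁)^{2−i} (a₂y + b₂)^j (c₂y + d₂)^{2−j}. Then, with Δ₁ := a₁d₁ − b₁c₁ and Δ₂ := a₂d₂ − b₂c₂, one has i₂(M[h]) = Δ₁² Δ₂² · i₂(h) and i₃(M[h]) = Δ₁³ Δ₂³ · i₃(h). -/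
open MvPolynomial

/-- `i₂(h) = 8 h₀₀ h₂₂ - 4 h₀₁ h₂₁ - 4 h₁₀ h₁₂ + 8 h₀₂ h₂₀ + h₁₁²`. -/
noncomputable def inv2 (h : MvPolynomial (Fin 2) ℂ) : ℂ :=
  8 * cf h 0 0 * cf h 2 2 - 4 * cf h 0 1 * cf h 2 1 - 4 * cf h 1 0 * cf h 1 2
    + 8 * cf h 0 2 * cf h 2 0 + (cf h 1 1) ^ 2

/-- The biquadratic `h(x,y) = Σ_{i,j=0}^{2} h_{ij} x^i y^j`. -/
noncomputable def biq (h : Fin 3 → Fin 3 → ℂ) : MvPolynomial (Fin 2) ℂ :=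
  ∑ i : Fin 3, ∑ j : Fin 3, C (h i j) * X 0 ^ (i : ℕ) * X 1 ^ (j : ℕ)

/-- The Möbius transform
`M[h](x,y) = Σ_{i,j=0}^{2} h_{ij} (a₁x+b₁)^i (c₁x+d₁)^{2-i} (a₂y+b₂)^j (c₂y+d₂)^{2-j}`. -/
noncomputable def mobBiq (h : Fin 3 → Fin 3 → ℂ) (a₁ b₁ c₁ d₁ a₂ b₂ c₂ d₂ : ℂ) :
    MvPolynomial (Fin 2) ℂ :=
  ∑ i : Fin 3, ∑ j : Fin 3,
    C (h i j) * (C a₁ * X 0 + C b₁) ^ (i : ℕ) * (C c₁ * X 0 + C d₁) ^ (2 - (i : ℕ))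
      * (C a₂ * X 1 + C b₂) ^ (j : ℕ) * (C c₂ * X 1 + C d₂) ^ (2 - (j : ℕ))

/-- The matrix whose row `k` lists the coefficients of `(a x + b)^k (c x + d)^(2 - k)`. -/
def symSqMatrix (a b c d : ℂ) : Matrix (Fin 3) (Fin 3) ℂ :=
  !![d ^ 2, 2 * c * d, c ^ 2;
     b * d, a * d + b * c, a * c;
     b ^ 2, 2 * a * b, a ^ 2]

lemma pow_mul_pow_eq_sum_symSqMatrix (a b c d : ℂ) (v : Fin 2) (k : Fin 3) :
    ((C a * X v + C b) ^ (k : ℕ) * (C c * X v + C d) ^ (2 - (k : ℕ)) : MvPolynomial (Fin 2) ℂ) =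
      ∑ i : Fin 3, C (symSqMatrix a b c d k i) * X v ^ (i : ℕ) := by
  have h2 : (C 2 : MvPolynomial (Fin 2) ℂ) = 2 := map_ofNat C 2
  fin_cases k <;> simp [symSqMatrix, Fin.sum_univ_three, h2] <;> ring

lemma det_symSqMatrix (a b c d : ℂ) : (symSqMatrix a b c d).det = (a * d - b * c) ^ 3 := by
  simp [symSqMatrix, Matrix.det_fin_three]
  ring

lemma cf_biq (h : Fin 3 → Fin 3 → ℂ) (i j : Fin 3) : cf (biq h) i j = h i j := by
  have key (k l : Fin 3) : (C (h k l) * X 0 ^ (k : ℕ) * X 1 ^ (l : ℕ) : MvPolynomial (Fin 2) ℂ) =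
      monomial (Finsupp.single 0 (k : ℕ) + Finsupp.single 1 (l : ℕ)) (h k l) := by
    rw [X_pow_eq_monomial, X_pow_eq_monomial, C_mul_monomial, monomial_mul]
    simp
  have inj (k l : Fin 3) : (Finsupp.single (0 : Fin 2) (k : ℕ) + Finsupp.single 1 (l : ℕ) =
      Finsupp.single 0 (i : ℕ) + Finsupp.single 1 (j : ℕ)) ↔ k = i ∧ l = j := by
    simp [Finsupp.ext_iff, Fin.forall_fin_two, Fin.val_inj]
  simp only [cf, biq, key, coeff_sum, coeff_monomial, inj, ite_and]
  simp

lemma mobBiq_eq_biq (h : Fin 3 → Fin 3 → ℂ) (a₁ b₁ c₁ d₁ a₂ b₂ c₂ d₂ : ℂ) :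
    mobBiq h a₁ b₁ c₁ d₁ a₂ b₂ c₂ d₂ =
      biq (Matrix.of.symm
        ((symSqMatrix a₁ b₁ c₁ d₁).transpose * (Matrix.of h * symSqMatrix a₂ b₂ c₂ d₂))) := by
  have key (k l : Fin 3) :
      (C (h k l) * (C a₁ * X 0 + C b₁) ^ (k : ℕ) * (C c₁ * X 0 + C d₁) ^ (2 - (k : ℕ))
        * (C a₂ * X 1 + C b₂) ^ (l : ℕ) * (C c₂ * X 1 + C d₂) ^ (2 - (l : ℕ)) :
          MvPolynomial (Fin 2) ℂ) =
      C (h k l) * (∑ i : Fin 3, C (symSqMatrix a₁ b₁ c₁ d₁ k i) * X 0 ^ (i : ℕ)) *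
        ∑ j : Fin 3, C (symSqMatrix a₂ b₂ c₂ d₂ l j) * X 1 ^ (j : ℕ) := by
    rw [← pow_mul_pow_eq_sum_symSqMatrix, ← pow_mul_pow_eq_sum_symSqMatrix]
    ring
  simp only [mobBiq, key, biq, Matrix.mul_apply, Matrix.transpose_apply, Matrix.of_apply,
    Matrix.of_symm_apply,
    Fin.sum_univ_three, map_add, map_mul]
  ring

lemma inv2_biq (h : Fin 3 → Fin 3 → ℂ) :
    inv2 (biq h) = 8 * h 0 0 * h 2 2 - 4 * h 0 1 * h 2 1 - 4 * h 1 0 * h 1 2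
      + 8 * h 0 2 * h 2 0 + h 1 1 ^ 2 := by
  simp only [inv2, ← cf_biq h]
  rfl

lemma inv3_biq (h : Fin 3 → Fin 3 → ℂ) : inv3 (biq h) = (Matrix.of h).det := by
  have e : inv3 (biq h) = Matrix.det !![h 2 2, h 2 1, h 2 0;
      h 1 2, h 1 1, h 1 0; h 0 2, h 0 1, h 0 0] := by
    simp only [inv3, ← cf_biq h]
    rfl
  rw [e]
  simp [Matrix.det_fin_three]
  ring

lemma inv2_biq_transpose_symSqMatrix_mul (H : Matrix (Fin 3) (Fin 3) ℂ) (a b c d : ℂ) :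
    inv2 (biq (Matrix.of.symm ((symSqMatrix a b c d).transpose * H))) =
      (a * d - b * c) ^ 2 * inv2 (biq (Matrix.of.symm H)) := by
  simp only [inv2_biq, Matrix.of_symm_apply, Matrix.mul_apply, Fin.sum_univ_three, Matrix.transpose_apply]
  simp [symSqMatrix]
  ring

lemma inv2_biq_mul_symSqMatrix (H : Matrix (Fin 3) (Fin 3) ℂ) (a b c d : ℂ) :
    inv2 (biq (Matrix.of.symm (H * symSqMatrix a b c d))) =
      (a * d - b * c) ^ 2 * inv2 (biq (Matrix.of.symm H)) := by
  simp only [inv2_biq, Matrix.of_symm_apply, Matrix.mul_apply, Fin.sum_univ_three]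
  simp [symSqMatrix]
  ring

/-- Under Möbius transformations of the two variables, `i₂` and `i₃` of a biquadratic
polynomial are multiplied by `Δ₁²Δ₂²` and `Δ₁³Δ₂³` respectively, where `Δᵢ = aᵢdᵢ - bᵢcᵢ`. -/
theorem statement10 (h : Fin 3 → Fin 3 → ℂ) (a₁ b₁ c₁ d₁ a₂ b₂ c₂ d₂ : ℂ) :
    inv2 (mobBiq h a₁ b₁ c₁ d₁ a₂ b₂ c₂ d₂) =
      (a₁ * d₁ - b₁ * c₁) ^ 2 * (a₂ * d₂ - b₂ * c₂) ^ 2 * inv2 (biq h) ∧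
    inv3 (mobBiq h a₁ b₁ c₁ d₁ a₂ b₂ c₂ d₂) =
      (a₁ * d₁ - b₁ * c₁) ^ 3 * (a₂ * d₂ - b₂ * c₂) ^ 3 * inv3 (biq h) := by
  rw [mobBiq_eq_biq]
  constructor
  · rw [inv2_biq_transpose_symSqMatrix_mul, inv2_biq_mul_symSqMatrix, mul_assoc, Equiv.symm_apply_apply]
  · rw [inv3_biq, inv3_biq, Equiv.apply_symm_apply, Matrix.det_mul, Matrix.det_mul, Matrix.det_transpose,
      det_symSqMatrix, det_symSqMatrix]
    ring
end
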